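/- Let the problem (P) be Levitin-Polyak well-posed in the extended sense. Then the penalty function F_c is globally exact if and only if the following three conditions hold: (1) F_c has the zero duality gap property; (2) F_c is non-degenerate in the extended sense; (3) F_c is locally exact at every globally optimal solution of (P). -/

import Mathlib

open Metric Filter Topology Set ENNReal Bornology

noncomputable section

/-- The set of globally optimal solutions of problem (P):
minimize `f x` subject to `x ∈ M` and `x ∈ Q`, where `fstar` is the optimal value. -/
def argminP {X : Type*} (M Q : Set X) (f : X → EReal) (fstar : ℝ) : Set X :=
  {x | x ∈ M ∩ Q ∧ f x = (fstar : EReal)}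

/-- `phi` is a penalty term (infeasibility measure) for the constraint `x ∈ M` on `Q`. -/
def IsPenaltyTerm {X : Type*} (M Q : Set X) (phi : X → ℝ≥0∞) : Prop :=
  ∀ x ∈ Q, (phi x = 0 ↔ x ∈ M)

/-- The penalty function `F_c x = f x + c * phi x`. -/
def Pen {X : Type*} (f : X → EReal) (phi : X → ℝ≥0∞) (c : ℝ) (x : X) : EReal :=
  f x + (c : EReal) * (phi x : EReal)

/-- Some subsequence of `x` converges to a point of `S`. -/
def HasSubseqConvTo {X : Type*} [MetricSpace X] (x : ℕ → X) (S : Set X) : Prop :=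
  ∃ (σ : ℕ → ℕ) (p : X), StrictMono σ ∧ p ∈ S ∧ Tendsto (fun k => x (σ k)) atTop (𝓝 p)

/-- Problem (P) is Tykhonov well-posed in the extended sense. -/
def TykhonovWPExt {X : Type*} [MetricSpace X] (M Q : Set X) (f : X → EReal) (fstar : ℝ) :
    Prop :=
  (argminP M Q f fstar).Nonempty ∧
    ∀ x : ℕ → X, (∀ n, x n ∈ M ∩ Q) →
      Tendsto (fun n => f (x n)) atTop (𝓝 (fstar : EReal)) →
      HasSubseqConvTo x (argminP M Q f fstar)

/-- Problem (P) is weakly Tykhonov well-posed in the extended sense. -/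
def WeakTykhonovWPExt {X : Type*} [MetricSpace X] (M Q : Set X) (f : X → EReal) (fstar : ℝ) :
    Prop :=
  (argminP M Q f fstar).Nonempty ∧
    ∀ x : ℕ → X, (∀ n, x n ∈ M ∩ Q) →
      Tendsto (fun n => f (x n)) atTop (𝓝 (fstar : EReal)) →
      Tendsto (fun n => infDist (x n) (argminP M Q f fstar)) atTop (𝓝 0)

/-- Problem (P) is Levitin-Polyak well-posed in the extended sense. -/
def LevitinPolyakWPExt {X : Type*} [MetricSpace X] (M Q : Set X) (f : X → EReal) (fstar : ℝ) :
    Prop :=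
  (argminP M Q f fstar).Nonempty ∧
    ∀ x : ℕ → X,
      Tendsto (fun n => f (x n)) atTop (𝓝 (fstar : EReal)) →
      Tendsto (fun n => infDist (x n) (M ∩ Q)) atTop (𝓝 0) →
      HasSubseqConvTo x (argminP M Q f fstar)

/-- Problem (P) is weakly Levitin-Polyak well-posed in the extended sense. -/
def WeakLevitinPolyakWPExt {X : Type*} [MetricSpace X] (M Q : Set X) (f : X → EReal)
    (fstar : ℝ) : Prop :=
  (argminP M Q f fstar).Nonempty ∧
    ∀ x : ℕ → X,
      Tendsto (fun n => f (x n)) atTop (𝓝 (fstar : EReal)) →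
      Tendsto (fun n => infDist (x n) (M ∩ Q)) atTop (𝓝 0) →
      Tendsto (fun n => infDist (x n) (argminP M Q f fstar)) atTop (𝓝 0)

/-- Problem (P) is Levitin-Polyak well-posed with respect to the infeasibility measure `phi`. -/
def LevitinPolyakWPwrt {X : Type*} [MetricSpace X] (M Q : Set X) (f : X → EReal)
    (phi : X → ℝ≥0∞) (fstar : ℝ) : Prop :=
  (argminP M Q f fstar).Nonempty ∧
    ∀ x : ℕ → X,
      Tendsto (fun n => f (x n)) atTop (𝓝 (fstar : EReal)) →
      Tendsto (fun n => phi (x n)) atTop (𝓝 (0 : ℝ≥0∞)) →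
      HasSubseqConvTo x (argminP M Q f fstar)

/-- Problem (P) is weakly Levitin-Polyak well-posed with respect to the infeasibility
measure `phi`. -/
def WeakLevitinPolyakWPwrt {X : Type*} [MetricSpace X] (M Q : Set X) (f : X → EReal)
    (phi : X → ℝ≥0∞) (fstar : ℝ) : Prop :=
  (argminP M Q f fstar).Nonempty ∧
    ∀ x : ℕ → X,
      Tendsto (fun n => f (x n)) atTop (𝓝 (fstar : EReal)) →
      Tendsto (fun n => phi (x n)) atTop (𝓝 (0 : ℝ≥0∞)) →
      Tendsto (fun n => infDist (x n) (argminP M Q f fstar)) atTop (𝓝 0)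

/-- `F` attains a global minimum on `Q`. -/
def AttainsGlobMin {X : Type*} (F : X → EReal) (Q : Set X) : Prop :=
  ∃ x ∈ Q, ∀ y ∈ Q, F x ≤ F y

/-- The penalty function `F_c` is globally exact: for all sufficiently large `c ≥ 0`
the set of global minimizers of `F_c` on `Q` coincides with `argminP`. -/
def GloballyExactPen {X : Type*} (M Q : Set X) (f : X → EReal) (phi : X → ℝ≥0∞)
    (fstar : ℝ) : Prop :=
  ∃ cs : ℝ, 0 ≤ cs ∧ ∀ c ≥ cs,
    {x | x ∈ Q ∧ ∀ y ∈ Q, Pen f phi c x ≤ Pen f phi c y} = argminP M Q f fstar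

/-- The zero duality gap property: `sup_{c ≥ 0} inf_{x ∈ Q} F_c x = fstar`. -/
def ZeroDualityGap {X : Type*} (Q : Set X) (f : X → EReal) (phi : X → ℝ≥0∞) (fstar : ℝ) :
    Prop :=
  (⨆ c : ℝ, ⨆ _ : (0 : ℝ) ≤ c, ⨅ x ∈ Q, Pen f phi c x) = (fstar : EReal)

/-- `x₀` is a local minimizer of `F` on `Q`. -/
def IsLocalMinOnSet {X : Type*} [MetricSpace X] (F : X → EReal) (Q : Set X) (x₀ : X) : Prop :=
  ∃ r > (0 : ℝ), ∀ x ∈ Q, dist x x₀ ≤ r → F x₀ ≤ F x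

/-- The penalty function `F_c` is locally exact at `x₀`. -/
def LocallyExactAt {X : Type*} [MetricSpace X] (f : X → EReal) (phi : X → ℝ≥0∞)
    (Q : Set X) (x₀ : X) : Prop :=
  ∃ cs : ℝ, 0 ≤ cs ∧ ∀ c ≥ cs, IsLocalMinOnSet (Pen f phi c) Q x₀

/-- The least exact penalty parameter `c_*(x₀)` at `x₀`. -/
def penCStarAt {X : Type*} [MetricSpace X] (f : X → EReal) (phi : X → ℝ≥0∞)
    (Q : Set X) (x₀ : X) : ℝ :=
  sInf {cs : ℝ | 0 ≤ cs ∧ ∀ c ≥ cs, IsLocalMinOnSet (Pen f phi c) Q x₀}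

/-- The radius of local exactness `r_*(x₀, cs)`: the supremum of all `r > 0` such that
`F_c x ≥ F_c x₀` for every `x ∈ B(x₀, r) ∩ Q` and every `c ≥ cs` (as an extended real). -/
def penRadiusAt {X : Type*} [MetricSpace X] (f : X → EReal) (phi : X → ℝ≥0∞)
    (Q : Set X) (x₀ : X) (cs : ℝ) : EReal :=
  sSup (Real.toEReal ''
    {r : ℝ | 0 < r ∧ ∀ c ≥ cs, ∀ x ∈ Q, dist x x₀ ≤ r → Pen f phi c x₀ ≤ Pen f phi c x})

/-- `F_c` is uniformly locally exact at globally optimal solutions of (P). -/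
def UniformlyLocallyExact {X : Type*} [MetricSpace X] (M Q : Set X) (f : X → EReal)
    (phi : X → ℝ≥0∞) (fstar : ℝ) : Prop :=
  (∀ x₀ ∈ argminP M Q f fstar, LocallyExactAt f phi Q x₀) ∧
    ∃ cs rs : ℝ, 0 < cs ∧ 0 < rs ∧
      ∀ x₀ ∈ argminP M Q f fstar,
        penCStarAt f phi Q x₀ < cs ∧ (rs : EReal) ≤ penRadiusAt f phi Q x₀ cs

/-- `F_c` is non-degenerate in the extended sense. -/
def NondegenerateExt {X : Type*} [MetricSpace X] (M Q : Set X) (f : X → EReal)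
    (phi : X → ℝ≥0∞) : Prop :=
  ∃ cs : ℝ, 0 ≤ cs ∧ ∃ xc : ℝ → X,
    (∀ c ≥ cs, xc c ∈ Q ∧ ∀ y ∈ Q, Pen f phi c (xc c) ≤ Pen f phi c y) ∧
    Tendsto (fun c => infDist (xc c) (M ∩ Q)) atTop (𝓝 0)
theorem Pen_mono {X : Type*} (f : X → EReal) (phi : X → ℝ≥0∞) {c d : ℝ} (hcd : c ≤ d) (x : X) :
    Pen f phi c x ≤ Pen f phi d x := by
  unfold Pen
  gcongr

theorem le_Pen {X : Type*} (f : X → EReal) (phi : X → ℝ≥0∞) {c : ℝ} (hc : 0 ≤ c) (x : X) :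
    f x ≤ Pen f phi c x := by
  simpa [Pen] using Pen_mono f phi hc x

theorem Pen_eq_of_mem_argminP {X : Type*} {M Q : Set X} {f : X → EReal} {phi : X → ℝ≥0∞}
    {fstar : ℝ} (hphi : IsPenaltyTerm M Q phi) {x : X} (hx : x ∈ argminP M Q f fstar) (c : ℝ) :
    Pen f phi c x = fstar := by
  simp [Pen, (hphi x hx.1.2).2 hx.1.1, hx.2]

/-- At a point where the penalty function is at most a real number, the objective function and the
penalty term are both finite. -/
theorem exists_real_of_Pen_le {X : Type*} {f : X → EReal} {phi : X → ℝ≥0∞} {c b : ℝ} {x : X}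
    (hc : 0 < c) (hbot : f x ≠ ⊥) (h : Pen f phi c x ≤ b) :
    ∃ a p : ℝ, 0 ≤ p ∧ phi x = ENNReal.ofReal p ∧ f x = a ∧
      ∀ d : ℝ, Pen f phi d x = ((a + d * p : ℝ) : EReal) := by
  have hf : f x ≠ ⊤ := fun h' => by
    have := (le_Pen f phi hc.le x).trans h
    rw [h', top_le_iff] at this
    exact EReal.coe_ne_top _ this
  lift f x to ℝ using ⟨hf, hbot⟩ with a ha
  have hp : phi x ≠ ⊤ := fun h' => by
    rw [Pen, h', ← ha, EReal.coe_ennreal_top, EReal.coe_mul_top_of_pos hc,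
      EReal.coe_add_top, top_le_iff] at h
    exact EReal.coe_ne_top _ h
  refine ⟨a, (phi x).toReal, ENNReal.toReal_nonneg, (ENNReal.ofReal_toReal hp).symm, rfl,
    fun d => ?_⟩
  rw [Pen, ← ha, ← EReal.coe_toReal (x := (phi x : EReal)) (by simpa using hp) (by simp),
    EReal.toReal_coe_ennreal]
  push_cast
  rfl

theorem ZeroDualityGap.exists_lt_Pen {X : Type*} {Q : Set X} {f : X → EReal} {phi : X → ℝ≥0∞}
    {fstar : ℝ} (h : ZeroDualityGap Q f phi fstar) {a : EReal} (ha : a < fstar) :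
    ∃ c : ℝ, 0 ≤ c ∧ ∀ x ∈ Q, a < Pen f phi c x := by
  rw [← h] at ha
  obtain ⟨c, hc⟩ := lt_iSup_iff.1 ha
  obtain ⟨hc0, hc⟩ := lt_iSup_iff.1 hc
  exact ⟨c, hc0, fun x hx => hc.trans_le (iInf₂_le x hx)⟩

theorem ZeroDualityGap.ne_bot {X : Type*} {Q : Set X} {f : X → EReal} {phi : X → ℝ≥0∞}
    {fstar : ℝ} (h : ZeroDualityGap Q f phi fstar) {x : X} (hx : x ∈ Q) : f x ≠ ⊥ := by
  obtain ⟨c, -, hc⟩ := h.exists_lt_Pen (EReal.bot_lt_coe fstar)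
  intro h'
  simpa [Pen, h'] using hc x hx

/-- Under the zero duality gap property, the objective function converges to the optimal value along
any path of points at which the penalty function does not exceed the optimal value. -/
theorem ZeroDualityGap.tendsto {X : Type*} {Q : Set X} {f : X → EReal} {phi : X → ℝ≥0∞}
    {fstar cs : ℝ} (h : ZeroDualityGap Q f phi fstar) {xc : ℝ → X}
    (hx : ∀ c ≥ cs, xc c ∈ Q ∧ Pen f phi c (xc c) ≤ fstar) :
    Tendsto (fun c => f (xc c)) atTop (𝓝 (fstar : EReal)) := by
  refine tendsto_order.2 ⟨fun a ha => ?_, fun a ha => ?_⟩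
  · obtain ⟨b, hab, hb⟩ := EReal.lt_iff_exists_real_btwn.1 ha
    have hb : b < fstar := by exact_mod_cast hb
    obtain ⟨d, hd, hdQ⟩ := h.exists_lt_Pen (a := (((b + fstar) / 2 : ℝ) : EReal))
      (by exact_mod_cast (by linarith : (b + fstar) / 2 < fstar))
    filter_upwards [eventually_ge_atTop cs, eventually_gt_atTop 0, eventually_ge_atTop (2 * d)]
      with c hcs hc0 hcd
    obtain ⟨hQ, hle⟩ := hx c hcs
    obtain ⟨A, p, hp, -, hA, hPen⟩ := exists_real_of_Pen_le hc0 (h.ne_bot hQ) hle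
    have h1 := hdQ _ hQ
    rw [hPen] at h1 hle
    rw [hA]
    have h1 : (b + fstar) / 2 < A + d * p := by exact_mod_cast h1
    have hle : A + c * p ≤ fstar := by exact_mod_cast hle
    refine hab.trans ?_
    have : b < A := by nlinarith [mul_le_mul_of_nonneg_right hcd hp]
    exact_mod_cast this
  · filter_upwards [eventually_ge_atTop cs, eventually_ge_atTop 0] with c hcs hc0
    exact ((le_Pen f phi hc0 _).trans (hx c hcs).2).trans_lt ha

/-- If the penalty function is bounded below by the optimal value for some value of the penalty
parameter, then it is globally exact. -/
theorem globallyExactPen_of_le_Pen {X : Type*} {M Q : Set X} {f : X → EReal} {phi : X → ℝ≥0∞}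
    {fstar d : ℝ} (hphi : IsPenaltyTerm M Q phi) (hne : (argminP M Q f fstar).Nonempty)
    (hbot : ∀ x ∈ Q, f x ≠ ⊥) (hd : 0 ≤ d) (hle : ∀ x ∈ Q, (fstar : EReal) ≤ Pen f phi d x) :
    GloballyExactPen M Q f phi fstar := by
  refine ⟨d + 1, by linarith, fun c hc => Set.ext fun x => ⟨fun ⟨hxQ, hx⟩ => ?_, fun hx =>
    ⟨hx.1.2, fun y hy => ?_⟩⟩⟩
  · obtain ⟨z, hz⟩ := hne
    have h1 := hx z hz.1.2
    rw [Pen_eq_of_mem_argminP hphi hz] at h1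
    obtain ⟨A, p, hp, hpx, hA, hPen⟩ := exists_real_of_Pen_le (by linarith) (hbot x hxQ) h1
    have h2 := hle x hxQ
    rw [hPen] at h1 h2
    have h1 : A + c * p ≤ fstar := by exact_mod_cast h1
    have h2 : fstar ≤ A + d * p := by exact_mod_cast h2
    have hp0 : p = 0 := by nlinarith
    subst hp0
    refine ⟨⟨(hphi x hxQ).1 (by simpa using hpx), hxQ⟩, ?_⟩
    rw [hA]
    exact_mod_cast (by linarith : A = fstar)
  · rw [Pen_eq_of_mem_argminP hphi hx]
    exact (hle y hy).trans (Pen_mono f phi (by linarith) y)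

/-- For a problem Levitin-Polyak well-posed in the extended sense, the
penalty function is globally exact iff it has the zero duality gap property, is
non-degenerate in the extended sense, and is locally exact at every globally optimal
solution. -/
theorem stmt15 {X : Type*} [MetricSpace X] (M Q : Set X) (f : X → EReal) (phi : X → ℝ≥0∞)
    (fstar : ℝ)
    (hM : M.Nonempty) (hQ : Q.Nonempty) (hfeas : (M ∩ Q).Nonempty)
    (hphi : IsPenaltyTerm M Q phi)
    (hopt : (⨅ x ∈ M ∩ Q, f x) = (fstar : EReal))
    (hwp : LevitinPolyakWPExt M Q f fstar) :
    GloballyExactPen M Q f phi fstar ↔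
      ZeroDualityGap Q f phi fstar ∧
        NondegenerateExt M Q f phi ∧
        (∀ x₀ ∈ argminP M Q f fstar, LocallyExactAt f phi Q x₀) := by
  obtain ⟨⟨z, hz⟩, hseq⟩ := hwp
  constructor
  · rintro ⟨cs, hcs, hex⟩
    have hmin : ∀ x ∈ argminP M Q f fstar, ∀ c ≥ cs, ∀ y ∈ Q, Pen f phi c x ≤ Pen f phi c y := by
      intro x hx c hc
      rw [← hex c hc] at hx
      exact hx.2
    refine ⟨le_antisymm (iSup₂_le fun c _ => ?_) ?_, ⟨cs, hcs, fun _ => z, ?_, ?_⟩, ?_⟩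
    · exact (iInf₂_le z hz.1.2).trans_eq (Pen_eq_of_mem_argminP hphi hz c)
    · refine le_iSup₂_of_le cs hcs (le_iInf₂ fun y hy => ?_)
      rw [← Pen_eq_of_mem_argminP hphi hz cs]
      exact hmin z hz cs le_rfl y hy
    · exact fun c hc => ⟨hz.1.2, hmin z hz c hc⟩
    · simp [infDist_zero_of_mem hz.1]
    · exact fun x hx => ⟨cs, hcs, fun c hc => ⟨1, one_pos, fun y hy _ => hmin x hx c hc y hy⟩⟩
  · rintro ⟨hgap, ⟨cs, hcs, xc, hxc, hdist⟩, hloc⟩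
    have hle : ∀ c ≥ cs, xc c ∈ Q ∧ Pen f phi c (xc c) ≤ fstar := fun c hc =>
      ⟨(hxc c hc).1, ((hxc c hc).2 z hz.1.2).trans_eq (Pen_eq_of_mem_argminP hphi hz c)⟩
    obtain ⟨σ, p, hσ, hp, hlim⟩ := hseq (fun n => xc n)
      ((hgap.tendsto hle).comp tendsto_natCast_atTop_atTop)
      (hdist.comp tendsto_natCast_atTop_atTop)
    obtain ⟨d, -, hd⟩ := hloc p hp
    obtain ⟨r, hr, hmin⟩ := hd d le_rfl
    have hσ' : Tendsto (fun k => (σ k : ℝ)) atTop atTop :=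
      tendsto_natCast_atTop_atTop.comp hσ.tendsto_atTop
    obtain ⟨k, hk, hkcs, hkd⟩ := ((hlim.eventually (closedBall_mem_nhds p hr)).and
      ((hσ'.eventually_ge_atTop cs).and (hσ'.eventually_ge_atTop d))).exists
    refine globallyExactPen_of_le_Pen hphi ⟨z, hz⟩ (fun x hx => hgap.ne_bot hx)
      (hcs.trans hkcs) fun x hx => ?_
    calc (fstar : EReal) = Pen f phi d p := (Pen_eq_of_mem_argminP hphi hp d).symm
      _ ≤ Pen f phi d (xc (σ k)) := hmin _ (hxc _ hkcs).1 hk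
      _ ≤ Pen f phi (σ k) (xc (σ k)) := Pen_mono f phi hkd _
      _ ≤ Pen f phi (σ k) x := (hxc _ hkcs).2 x hx
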